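/- Let n ≥ 1, let u₀, u₁ : ℝⁿ → ℝ be smooth with ∇u₀, ∇u₁, and u₁ − u₀ ℤⁿ-periodic, let Θ ∈ [(n−1)π/2, (n+1)π/2), and let τ ∈ (0,1]. Suppose v : [0,√τ] × ℝⁿ → ℝ is smooth, ℤⁿ-periodic in x, vanishes on {0, √τ} × ℝⁿ, and satisfies ∑_{j=1}^{n+1} arctan λ_j(D²(ũ^τ + v)(s,x)) = Θ for all (s,x). Then, with λ̄ = τ · max{sup_x Δu₀(x), sup_x Δu₁(x)}, one has v(s,x) ≤ (λ̄/2)·(s/√τ)·(1 − s/√τ) for all (s,x) ∈ [0,√τ] × ℝⁿ. -/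

import Mathlib

/-- The Lagrangian phase `ϑ(M) = ∑ arctan λ_j(M)` of a real symmetric matrix, where the
`λ_j(M)` are its eigenvalues listed with multiplicity; `0` if `M` is not symmetric. -/
noncomputable def lagPhase {ι : Type*} [Fintype ι] [DecidableEq ι]
    (M : Matrix ι ι ℝ) : ℝ :=
  if h : M.IsHermitian then ∑ j, Real.arctan (h.eigenvalues j) else 0

/-- The Hessian matrix of a function `f : ℝ^m → ℝ` at a point `x`. -/
noncomputable def hess {m : ℕ} (f : (Fin m → ℝ) → ℝ) (x : Fin m → ℝ) :
    Matrix (Fin m) (Fin m) ℝ :=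
  Matrix.of fun i j => fderiv ℝ (fun y => fderiv ℝ f y (Pi.single j 1)) x (Pi.single i 1)

/-- The Laplacian of `f : ℝ^m → ℝ` at `x`: the trace of the Hessian. -/
noncomputable def lap {m : ℕ} (f : (Fin m → ℝ) → ℝ) (x : Fin m → ℝ) : ℝ :=
  ∑ i, hess f x i i

theorem sum_nonneg_of_le_sum_arctan {ι : Type*} [Fintype ι] [DecidableEq ι]
    (hcard : 2 ≤ Fintype.card ι) (a : ι → ℝ)
    (h : ((Fintype.card ι : ℝ) - 2) * (Real.pi / 2) ≤ ∑ i, Real.arctan (a i)) :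
    0 ≤ ∑ i, a i := by
  by_cases hneg : ∃ j, a j < 0
  · obtain ⟨j, hj⟩ := hneg
    have key : ∀ i, i ≠ j → -a j ≤ a i := by
      intro i hij
      have hi : i ∈ Finset.univ.erase j := by simp [hij]
      have hsum : ∑ l, Real.arctan (a l) = Real.arctan (a j) + (Real.arctan (a i) +
          ∑ l ∈ (Finset.univ.erase j).erase i, Real.arctan (a l)) := by
        rw [Finset.add_sum_erase _ (fun l => Real.arctan (a l)) hi,
          Finset.add_sum_erase _ (fun l => Real.arctan (a l)) (Finset.mem_univ j)]
      have hrest : ∑ l ∈ (Finset.univ.erase j).erase i, Real.arctan (a l)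
          ≤ ((Fintype.card ι : ℝ) - 2) * (Real.pi / 2) := by
        have hle := Finset.sum_le_card_nsmul ((Finset.univ.erase j).erase i)
          (fun l => Real.arctan (a l)) (Real.pi / 2) (fun l _ => (Real.arctan_lt_pi_div_two _).le)
        rw [Finset.card_erase_of_mem hi, Finset.card_erase_of_mem (Finset.mem_univ j),
          Finset.card_univ, nsmul_eq_mul, Nat.sub_sub, Nat.cast_sub hcard] at hle
        exact_mod_cast hle
      have harc : Real.arctan (-a j) ≤ Real.arctan (a i) := by
        rw [Real.arctan_neg]; linarith
      exact Real.arctan_strictMono.le_iff_le.mp harc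
    obtain ⟨i, hij⟩ : ∃ i, i ≠ j :=
      Fintype.exists_ne_of_one_lt_card (by omega) j
    have hi : i ∈ Finset.univ.erase j := by simp [hij]
    rw [← Finset.add_sum_erase _ a (Finset.mem_univ j), ← Finset.add_sum_erase _ a hi]
    have hnn : 0 ≤ ∑ l ∈ (Finset.univ.erase j).erase i, a l := by
      refine Finset.sum_nonneg fun l hl => ?_
      have := key l (by simp at hl; tauto)
      linarith
    linarith [key i hij]
  · push Not at hneg
    exact Finset.sum_nonneg fun i _ => hneg i

theorem deriv_comp_line {m : ℕ} {f : (Fin m → ℝ) → ℝ} (hf : Differentiable ℝ f)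
    (x e : Fin m → ℝ) :
    deriv (fun t : ℝ => f (x + t • e)) = fun t => fderiv ℝ f (x + t • e) e := by
  ext t
  have hl : HasDerivAt (fun t : ℝ => x + t • e) e t := by
    simpa using ((hasDerivAt_id t).smul_const e).const_add x
  exact ((hf _).hasFDerivAt.comp_hasDerivAt t hl).deriv

theorem contDiff_fderiv_apply {m : ℕ} {f : (Fin m → ℝ) → ℝ}
    (hf : ContDiff ℝ (⊤ : ℕ∞) f) (e : Fin m → ℝ) :
    ContDiff ℝ (⊤ : ℕ∞) fun y => fderiv ℝ f y e :=
  (hf.fderiv_right (m := ((⊤ : ℕ∞) : WithTop ℕ∞)) (by simp)).clm_apply contDiff_const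

theorem hess_diag_eq_deriv_deriv {m : ℕ} {f : (Fin m → ℝ) → ℝ}
    (hf : ContDiff ℝ (⊤ : ℕ∞) f) (x : Fin m → ℝ) (i : Fin m) :
    hess f x i i = deriv (deriv fun t : ℝ => f (x + t • Pi.single i (1 : ℝ))) 0 := by
  rw [deriv_comp_line (hf.differentiable (by simp)),
    deriv_comp_line ((contDiff_fderiv_apply hf _).differentiable (by simp))]
  simp [hess]

theorem hess_isHermitian {m : ℕ} {f : (Fin m → ℝ) → ℝ}
    (hf : ContDiff ℝ (⊤ : ℕ∞) f) (x : Fin m → ℝ) : (hess f x).IsHermitian := by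
  have hd : DifferentiableAt ℝ (fderiv ℝ f) x :=
    ((hf.fderiv_right (m := ((⊤ : ℕ∞) : WithTop ℕ∞)) (by simp)).differentiable (by simp)) x
  have htwo : (2 : WithTop ℕ∞) ≤ ((⊤ : ℕ∞) : WithTop ℕ∞) := WithTop.coe_le_coe.mpr le_top
  have hsymm : IsSymmSndFDerivAt ℝ f x := hf.contDiffAt.isSymmSndFDerivAt (by simpa using htwo)
  ext i j
  simp only [hess, Matrix.conjTranspose_apply, Matrix.of_apply, star_trivial]
  rw [fderiv_clm_apply hd (differentiableAt_const _), fderiv_clm_apply hd (differentiableAt_const _)]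
  simpa using hsymm (Pi.single j 1) (Pi.single i 1)

theorem lap_nonneg_of_le_lagPhase {n : ℕ} (hn : 1 ≤ n) {f : (Fin (n + 1) → ℝ) → ℝ}
    (hf : ContDiff ℝ (⊤ : ℕ∞) f) (x : Fin (n + 1) → ℝ)
    (h : ((n : ℝ) - 1) * Real.pi / 2 ≤ lagPhase (hess f x)) : 0 ≤ lap f x := by
  have hH := hess_isHermitian hf x
  rw [lagPhase, dif_pos hH] at h
  have htr := hH.trace_eq_sum_eigenvalues
  simp only [RCLike.ofReal_real_eq_id, id_eq] at htr
  change 0 ≤ (hess f x).trace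
  rw [htr]
  refine sum_nonneg_of_le_sum_arctan (by simpa using hn) _ ?_
  refine le_trans (le_of_eq ?_) h
  simp only [Fintype.card_fin]
  push_cast
  ring

theorem deriv_deriv_nonpos_of_isLocalMax {f : ℝ → ℝ} {a : ℝ} (hf : ContinuousAt f a)
    (h : IsLocalMax f a) : deriv (deriv f) a ≤ 0 := by
  by_contra! hpos
  have hmin := isLocalMin_of_deriv_deriv_pos hpos h.deriv_eq_zero hf
  have hconst : f =ᶠ[nhds a] fun _ => f a := by
    filter_upwards [h, hmin] with y h₁ h₂
    exact le_antisymm h₁ h₂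
  have := hconst.deriv.deriv_eq
  simp at this
  linarith

theorem exists_add_int_mem_Icc {n : ℕ} (x : Fin n → ℝ) :
    ∃ k : Fin n → ℤ, (x + fun j => (k j : ℝ)) ∈ Set.Icc (0 : Fin n → ℝ) 1 := by
  refine ⟨fun j => -⌊x j⌋, fun j => ?_, fun j => ?_⟩
  · simpa using Int.floor_le (x j)
  · have := (Int.lt_floor_add_one (x j)).le
    simp only [Pi.add_apply, Int.cast_neg, Pi.one_apply]
    linarith

theorem continuous_lap {m : ℕ} {f : (Fin m → ℝ) → ℝ} (hf : ContDiff ℝ (⊤ : ℕ∞) f) :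
    Continuous (lap f) :=
  continuous_finsetSum _ fun i _ =>
    (contDiff_fderiv_apply (contDiff_fderiv_apply hf (Pi.single i 1)) (Pi.single i 1)).continuous

theorem bddAbove_range_lap {n : ℕ} {u : (Fin n → ℝ) → ℝ} (hu : ContDiff ℝ (⊤ : ℕ∞) u)
    (hper : ∀ (x : Fin n → ℝ) (k : Fin n → ℤ),
      fderiv ℝ u (x + fun j => (k j : ℝ)) = fderiv ℝ u x) :
    BddAbove (Set.range (lap u)) := by
  have hlap : ∀ (x : Fin n → ℝ) (k : Fin n → ℤ), lap u (x + fun j => (k j : ℝ)) = lap u x := by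
    intro x k
    refine Finset.sum_congr rfl fun i _ => ?_
    simp only [hess, Matrix.of_apply]
    rw [← fderiv_comp_add_right (f := fun y => fderiv ℝ u y (Pi.single i 1))]
    simp only [hper]
  obtain ⟨C, hC⟩ := (isCompact_Icc (a := (0 : Fin n → ℝ)) (b := 1)).bddAbove_image
    (continuous_lap hu).continuousOn
  refine ⟨C, ?_⟩
  rintro _ ⟨x, rfl⟩
  obtain ⟨k, hk⟩ := exists_add_int_mem_Icc x
  rw [← hlap x k]
  exact hC ⟨_, hk, rfl⟩

theorem contDiff_line {m : ℕ} {f : (Fin m → ℝ) → ℝ} (hf : ContDiff ℝ (⊤ : ℕ∞) f)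
    (x e : Fin m → ℝ) : ContDiff ℝ (⊤ : ℕ∞) fun t : ℝ => f (x + t • e) :=
  hf.comp (by fun_prop)

theorem deriv_deriv_combination {α β γ : ℝ → ℝ} (hα : ContDiff ℝ (⊤ : ℕ∞) α)
    (hβ : ContDiff ℝ (⊤ : ℕ∞) β) (hγ : ContDiff ℝ (⊤ : ℕ∞) γ) (a b t : ℝ) :
    deriv (deriv fun t => a * α t + b * β t + γ t) t
      = a * deriv (deriv α) t + b * deriv (deriv β) t + deriv (deriv γ) t := by
  have hd : ∀ {f : ℝ → ℝ}, ContDiff ℝ (⊤ : ℕ∞) f → Differentiable ℝ f :=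
    fun h => h.differentiable (by simp)
  have hdd : ∀ {f : ℝ → ℝ}, ContDiff ℝ (⊤ : ℕ∞) f → Differentiable ℝ (deriv f) :=
    fun h => hd (contDiff_infty_iff_deriv.mp h).2
  have h₁ : (deriv fun t => a * α t + b * β t + γ t)
      = fun t => a * deriv α t + b * deriv β t + deriv γ t := by
    ext t
    exact ((((hd hα t).hasDerivAt.const_mul a).add ((hd hβ t).hasDerivAt.const_mul b)).add
      (hd hγ t).hasDerivAt).deriv
  rw [h₁]
  exact ((((hdd hα t).hasDerivAt.const_mul a).add ((hdd hβ t).hasDerivAt.const_mul b)).add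
    (hdd hγ t).hasDerivAt).deriv

theorem deriv_deriv_affine (a b t : ℝ) : deriv (deriv fun t : ℝ => a + b * t) t = 0 := by
  have : (deriv fun t : ℝ => a + b * t) = fun _ => b := by
    ext t
    simp
  simp [this]

theorem deriv_deriv_mul_sub (a r t : ℝ) :
    deriv (deriv fun t : ℝ => (a + t) * (r - (a + t))) t = -2 := by
  have h₁ : (deriv fun t : ℝ => (a + t) * (r - (a + t))) = fun t => (r - 2 * a) + (-2) * t := by
    ext t
    have h := ((hasDerivAt_id t).const_add a)
    refine (h.mul (h.const_sub r)).deriv.trans ?_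
    simp only [id]
    ring
  rw [h₁]
  simp

theorem contDiff_interpolation {n : ℕ} {u₀ u₁ : (Fin n → ℝ) → ℝ} {v : (Fin (n + 1) → ℝ) → ℝ}
    (hu₀ : ContDiff ℝ (⊤ : ℕ∞) u₀) (hu₁ : ContDiff ℝ (⊤ : ℕ∞) u₁)
    (hv : ContDiff ℝ (⊤ : ℕ∞) v) (r : ℝ) :
    ContDiff ℝ (⊤ : ℕ∞) fun p : Fin (n + 1) → ℝ =>
      (1 - p 0 / r) * u₀ (Fin.tail p) + (p 0 / r) * u₁ (Fin.tail p) + v p := by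
  have htail : ContDiff ℝ (⊤ : ℕ∞) fun p : Fin (n + 1) → ℝ => (Fin.tail p : Fin n → ℝ) := by
    unfold Fin.tail
    fun_prop
  have h₀ := hu₀.comp htail
  have h₁ := hu₁.comp htail
  have hp : ContDiff ℝ (⊤ : ℕ∞) fun p : Fin (n + 1) → ℝ => p 0 / r := by fun_prop
  exact (((contDiff_const.sub hp).mul h₀).add (hp.mul h₁)).add hv

theorem lap_interpolation {n : ℕ} {u₀ u₁ : (Fin n → ℝ) → ℝ} {v : (Fin (n + 1) → ℝ) → ℝ}
    (hu₀ : ContDiff ℝ (⊤ : ℕ∞) u₀) (hu₁ : ContDiff ℝ (⊤ : ℕ∞) u₁)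
    (hv : ContDiff ℝ (⊤ : ℕ∞) v) (r : ℝ) (p : Fin (n + 1) → ℝ) :
    lap (fun p : Fin (n + 1) → ℝ =>
        (1 - p 0 / r) * u₀ (Fin.tail p) + (p 0 / r) * u₁ (Fin.tail p) + v p) p
      = (1 - p 0 / r) * lap u₀ (Fin.tail p) + (p 0 / r) * lap u₁ (Fin.tail p) + lap v p := by
  have hU := contDiff_interpolation hu₀ hu₁ hv r
  simp only [lap]
  rw [Fin.sum_univ_succ, Fin.sum_univ_succ (f := fun i => hess v p i i)]
  have hzero : hess (fun p : Fin (n + 1) → ℝ =>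
      (1 - p 0 / r) * u₀ (Fin.tail p) + (p 0 / r) * u₁ (Fin.tail p) + v p) p 0 0
      = hess v p 0 0 := by
    rw [hess_diag_eq_deriv_deriv hU, hess_diag_eq_deriv_deriv hv]
    have htail : ∀ t : ℝ, Fin.tail (p + t • Pi.single 0 (1 : ℝ)) = Fin.tail p := by
      intro t
      ext j
      simp [Fin.tail]
    have hfun : (fun t : ℝ => (1 - (p + t • Pi.single 0 (1 : ℝ) : Fin (n + 1) → ℝ) 0 / r)
          * u₀ (Fin.tail (p + t • Pi.single 0 (1 : ℝ)))
          + ((p + t • Pi.single 0 (1 : ℝ) : Fin (n + 1) → ℝ) 0 / r)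
          * u₁ (Fin.tail (p + t • Pi.single 0 (1 : ℝ))) + v (p + t • Pi.single 0 (1 : ℝ)))
        = fun t => 1 * (((1 - p 0 / r) * u₀ (Fin.tail p) + p 0 / r * u₁ (Fin.tail p))
          + ((u₁ (Fin.tail p) - u₀ (Fin.tail p)) / r) * t) + 0 * t
          + v (p + t • Pi.single 0 (1 : ℝ)) := by
      ext t
      rw [htail]
      simp only [Pi.add_apply, Pi.smul_apply, Pi.single_eq_same, smul_eq_mul]
      ring
    rw [hfun, deriv_deriv_combination (by fun_prop) (by fun_prop) (contDiff_line hv _ _),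
      deriv_deriv_affine]
    ring
  have hsucc : ∀ j : Fin n, hess (fun p : Fin (n + 1) → ℝ =>
      (1 - p 0 / r) * u₀ (Fin.tail p) + (p 0 / r) * u₁ (Fin.tail p) + v p) p j.succ j.succ
      = (1 - p 0 / r) * hess u₀ (Fin.tail p) j j + (p 0 / r) * hess u₁ (Fin.tail p) j j
        + hess v p j.succ j.succ := by
    intro j
    rw [hess_diag_eq_deriv_deriv hU, hess_diag_eq_deriv_deriv hv, hess_diag_eq_deriv_deriv hu₀,
      hess_diag_eq_deriv_deriv hu₁, ← deriv_deriv_combination (contDiff_line hu₀ _ _)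
      (contDiff_line hu₁ _ _) (contDiff_line hv _ _)]
    have htail : ∀ t : ℝ, Fin.tail (p + t • Pi.single j.succ (1 : ℝ))
        = Fin.tail p + t • Pi.single j (1 : ℝ) := by
      intro t
      ext l
      simp [Fin.tail, Pi.single_apply]
    simp only [htail]
    simp
  rw [hzero, Finset.sum_congr rfl fun j _ => hsucc j, Finset.sum_add_distrib,
    Finset.sum_add_distrib, Finset.mul_sum, Finset.mul_sum]
  ring

theorem lap_sub_parabola {n : ℕ} {v : (Fin (n + 1) → ℝ) → ℝ} (hv : ContDiff ℝ (⊤ : ℕ∞) v)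
    (c r : ℝ) (p : Fin (n + 1) → ℝ) :
    lap (fun p => v p - c * (p 0 * (r - p 0))) p = lap v p + 2 * c := by
  have hg : ContDiff ℝ (⊤ : ℕ∞) fun p : Fin (n + 1) → ℝ => v p - c * (p 0 * (r - p 0)) := by
    fun_prop
  simp only [lap]
  rw [Fin.sum_univ_succ, Fin.sum_univ_succ (f := fun i => hess v p i i)]
  have hzero : hess (fun p => v p - c * (p 0 * (r - p 0))) p 0 0 = hess v p 0 0 + 2 * c := by
    rw [hess_diag_eq_deriv_deriv hg, hess_diag_eq_deriv_deriv hv]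
    have hfun : (fun t : ℝ => v (p + t • Pi.single 0 (1 : ℝ))
          - c * ((p + t • Pi.single 0 (1 : ℝ) : Fin (n + 1) → ℝ) 0
            * (r - (p + t • Pi.single 0 (1 : ℝ) : Fin (n + 1) → ℝ) 0)))
        = fun t => (-c) * ((p 0 + t) * (r - (p 0 + t))) + 0 * t
          + v (p + t • Pi.single 0 (1 : ℝ)) := by
      ext t
      simp only [Pi.add_apply, Pi.smul_apply, Pi.single_eq_same, smul_eq_mul]
      ring
    rw [hfun, deriv_deriv_combination (by fun_prop) (by fun_prop) (contDiff_line hv _ _),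
      deriv_deriv_mul_sub]
    ring
  have hsucc : ∀ j : Fin n, hess (fun p => v p - c * (p 0 * (r - p 0))) p j.succ j.succ
      = hess v p j.succ j.succ := by
    intro j
    rw [hess_diag_eq_deriv_deriv hg, hess_diag_eq_deriv_deriv hv]
    have hfun : (fun t : ℝ => v (p + t • Pi.single j.succ (1 : ℝ))
          - c * ((p + t • Pi.single j.succ (1 : ℝ) : Fin (n + 1) → ℝ) 0
            * (r - (p + t • Pi.single j.succ (1 : ℝ) : Fin (n + 1) → ℝ) 0)))
        = fun t => 1 * (-(c * (p 0 * (r - p 0))) + 0 * t) + 0 * t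
          + v (p + t • Pi.single j.succ (1 : ℝ)) := by
      ext t
      simp
      ring
    rw [hfun, deriv_deriv_combination (by fun_prop) (by fun_prop) (contDiff_line hv _ _),
      deriv_deriv_affine]
    ring
  rw [hzero, Finset.sum_congr rfl fun j _ => hsucc j]
  ring

theorem lap_nonpos_of_isLocalMax {m : ℕ} {f : (Fin m → ℝ) → ℝ} (hf : ContDiff ℝ (⊤ : ℕ∞) f)
    {x : Fin m → ℝ} (h : IsLocalMax f x) : lap f x ≤ 0 := by
  refine Finset.sum_nonpos fun i _ => ?_
  rw [hess_diag_eq_deriv_deriv hf]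
  have hcont := (contDiff_line hf x (Pi.single i 1)).continuous
  refine deriv_deriv_nonpos_of_isLocalMax hcont.continuousAt ?_
  have hline : Filter.Tendsto (fun t : ℝ => x + t • Pi.single i (1 : ℝ)) (nhds 0) (nhds x) := by
    have : Continuous fun t : ℝ => x + t • (Pi.single i (1 : ℝ) : Fin m → ℝ) := by fun_prop
    simpa using this.tendsto 0
  have := hline.eventually h
  simpa [IsLocalMax, IsMaxFilter] using this

/-- Strict maximum principle on the strip `[0, r] × ℝⁿ`, for functions periodic in the last
`n` variables. -/
theorem nonpos_of_lap_pos_of_periodic {n : ℕ} {g : (Fin (n + 1) → ℝ) → ℝ}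
    (hg : ContDiff ℝ (⊤ : ℕ∞) g) {r : ℝ} (hr : 0 < r)
    (hper : ∀ (s : ℝ) (x : Fin n → ℝ) (k : Fin n → ℤ),
      g (Fin.cons s (x + fun j => (k j : ℝ))) = g (Fin.cons s x))
    (hg₀ : ∀ x : Fin n → ℝ, g (Fin.cons 0 x) = 0) (hg₁ : ∀ x : Fin n → ℝ, g (Fin.cons r x) = 0)
    (hlap : ∀ s ∈ Set.Icc (0 : ℝ) r, ∀ x : Fin n → ℝ, 0 < lap g (Fin.cons s x)) :
    ∀ s ∈ Set.Icc (0 : ℝ) r, ∀ x : Fin n → ℝ, g (Fin.cons s x) ≤ 0 := by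
  have hcons : Continuous fun q : ℝ × (Fin n → ℝ) => g (Fin.cons q.1 q.2) :=
    hg.continuous.comp (by fun_prop)
  obtain ⟨⟨s₀, x₀⟩, hmem, hmax⟩ := ((isCompact_Icc (a := (0 : ℝ)) (b := r)).prod
    (isCompact_Icc (a := (0 : Fin n → ℝ)) (b := 1))).exists_isMaxOn
    ⟨(0, 0), ⟨⟨le_rfl, hr.le⟩, ⟨le_rfl, zero_le_one⟩⟩⟩ hcons.continuousOn
  have hle : ∀ s ∈ Set.Icc (0 : ℝ) r, ∀ x : Fin n → ℝ,
      g (Fin.cons s x) ≤ g (Fin.cons s₀ x₀) := by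
    intro s hs x
    obtain ⟨k, hk⟩ := exists_add_int_mem_Icc x
    rw [← hper s x k]
    exact hmax (a := (s, x + fun j => (k j : ℝ))) ⟨hs, hk⟩
  have hs₀ : s₀ ∈ Set.Icc (0 : ℝ) r := hmem.1
  suffices h : g (Fin.cons s₀ x₀) ≤ 0 from fun s hs x => (hle s hs x).trans h
  by_contra! hpos
  have hlt₀ : 0 < s₀ := by
    refine lt_of_le_of_ne hs₀.1 ?_
    rintro rfl
    exact hpos.ne' (hg₀ x₀)
  have hlt₁ : s₀ < r := by
    refine lt_of_le_of_ne hs₀.2 ?_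
    rintro rfl
    exact hpos.ne' (hg₁ x₀)
  have hloc : IsLocalMax g (Fin.cons s₀ x₀) := by
    have hnear : ∀ᶠ p : Fin (n + 1) → ℝ in nhds (Fin.cons s₀ x₀), p 0 ∈ Set.Ioo 0 r :=
      (continuous_apply (0 : Fin (n + 1))).continuousAt.eventually_mem
        (by simpa using Ioo_mem_nhds hlt₀ hlt₁)
    filter_upwards [hnear] with p hp
    rw [← Fin.cons_self_tail p]
    exact hle _ ⟨hp.1.le, hp.2.le⟩ _
  exact (hlap s₀ hs₀ x₀).not_ge (lap_nonpos_of_isLocalMax hg hloc)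

/-- (Upper barrier estimate.) Let `n ≥ 1`, `u₀, u₁` smooth with `∇u₀`,
`∇u₁`, `u₁ - u₀` ℤⁿ-periodic, `Θ ∈ [(n-1)π/2, (n+1)π/2)`, `τ ∈ (0, 1]`. If `v` is a
smooth solution of `∑ arctan λ_j(D²(ũ^τ + v)) = Θ` on `[0, √τ] × 𝕋ⁿ` vanishing on
`{0, √τ} × ℝⁿ`, then with `λ̄ = τ · max (sup Δu₀) (sup Δu₁)` one has
`v(s, x) ≤ (λ̄/2)·(s/√τ)·(1 - s/√τ)` on the cylinder. -/
theorem stmt18 {n : ℕ} (hn : 1 ≤ n) (u₀ u₁ : (Fin n → ℝ) → ℝ)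
    (hu₀ : ContDiff ℝ (⊤ : ℕ∞) u₀) (hu₁ : ContDiff ℝ (⊤ : ℕ∞) u₁)
    (hper₀ : ∀ (x : Fin n → ℝ) (k : Fin n → ℤ),
      fderiv ℝ u₀ (x + fun j => (k j : ℝ)) = fderiv ℝ u₀ x)
    (hper₁ : ∀ (x : Fin n → ℝ) (k : Fin n → ℤ),
      fderiv ℝ u₁ (x + fun j => (k j : ℝ)) = fderiv ℝ u₁ x)
    (hdiff : ∀ (x : Fin n → ℝ) (k : Fin n → ℤ),
      u₁ (x + fun j => (k j : ℝ)) - u₀ (x + fun j => (k j : ℝ)) = u₁ x - u₀ x)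
    (Θ : ℝ) (hΘ₁ : ((n : ℝ) - 1) * Real.pi / 2 ≤ Θ) (hΘ₂ : Θ < ((n : ℝ) + 1) * Real.pi / 2)
    (τ : ℝ) (hτ : τ ∈ Set.Ioc (0 : ℝ) 1)
    (v : (Fin (n + 1) → ℝ) → ℝ) (hv : ContDiff ℝ (⊤ : ℕ∞) v)
    (hvper : ∀ (s : ℝ) (x : Fin n → ℝ) (k : Fin n → ℤ),
      v (Fin.cons s (x + fun j => (k j : ℝ))) = v (Fin.cons s x))
    (hv0 : ∀ x : Fin n → ℝ, v (Fin.cons 0 x) = 0)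
    (hv1 : ∀ x : Fin n → ℝ, v (Fin.cons (Real.sqrt τ) x) = 0)
    (heq : ∀ s ∈ Set.Icc (0 : ℝ) (Real.sqrt τ), ∀ x : Fin n → ℝ,
      lagPhase (hess (fun p => (1 - p 0 / Real.sqrt τ) * u₀ (Fin.tail p)
          + (p 0 / Real.sqrt τ) * u₁ (Fin.tail p) + v p) (Fin.cons s x)) = Θ) :
    ∀ s ∈ Set.Icc (0 : ℝ) (Real.sqrt τ), ∀ x : Fin n → ℝ,
      v (Fin.cons s x)
        ≤ τ * max (⨆ y, lap u₀ y) (⨆ y, lap u₁ y) / 2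
            * (s / Real.sqrt τ) * (1 - s / Real.sqrt τ) := by
  have hr : 0 < Real.sqrt τ := Real.sqrt_pos.mpr hτ.1
  have hrr : Real.sqrt τ * Real.sqrt τ = τ := Real.mul_self_sqrt hτ.1.le
  set r := Real.sqrt τ
  set M := max (⨆ y, lap u₀ y) (⨆ y, lap u₁ y) with hM
  have hM₀ : ∀ y, lap u₀ y ≤ M := fun y =>
    (le_ciSup (bddAbove_range_lap hu₀ hper₀) y).trans (le_max_left _ _)
  have hM₁ : ∀ y, lap u₁ y ≤ M := fun y =>
    (le_ciSup (bddAbove_range_lap hu₁ hper₁) y).trans (le_max_right _ _)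
  have hlapv : ∀ s ∈ Set.Icc (0 : ℝ) r, ∀ x : Fin n → ℝ, -M ≤ lap v (Fin.cons s x) := by
    intro s hs x
    have h := lap_nonneg_of_le_lagPhase hn (contDiff_interpolation hu₀ hu₁ hv r) (Fin.cons s x)
      (hΘ₁.trans (heq s hs x).ge)
    rw [lap_interpolation hu₀ hu₁ hv] at h
    simp only [Fin.cons_zero, Fin.tail_cons] at h
    have hσ₀ : 0 ≤ s / r := div_nonneg hs.1 hr.le
    have hσ₁ : 0 ≤ 1 - s / r := sub_nonneg.mpr ((div_le_one hr).mpr hs.2)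
    have h₀ := mul_le_mul_of_nonneg_left (hM₀ x) hσ₁
    have h₁ := mul_le_mul_of_nonneg_left (hM₁ x) hσ₀
    linarith
  have hbound : ∀ ε > 0, ∀ s ∈ Set.Icc (0 : ℝ) r, ∀ x : Fin n → ℝ,
      v (Fin.cons s x) - (M + ε) / 2 * (s * (r - s)) ≤ 0 := by
    intro ε hε
    have hmax := nonpos_of_lap_pos_of_periodic
      (g := fun p => v p - (M + ε) / 2 * (p 0 * (r - p 0))) (by fun_prop) hr
      (fun s x k => by simp [hvper]) (fun x => by simp [hv0]) (fun x => by simp [hv1])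
      (fun s hs x => by
        rw [lap_sub_parabola hv]
        linarith [hlapv s hs x])
    simpa only [Fin.cons_zero] using hmax
  intro s hs x
  have hbarrier : τ * M / 2 * (s / r) * (1 - s / r) = M / 2 * (s * (r - s)) := by
    rw [← hrr]
    field_simp
  rw [hbarrier]
  refine le_of_forall_pos_le_add fun δ hδ => ?_
  have hq : 0 ≤ s * (r - s) := mul_nonneg hs.1 (sub_nonneg.mpr hs.2)
  have h := hbound (δ / (s * (r - s) + 1)) (by positivity) s hs x
  have hsmall : δ / (s * (r - s) + 1) / 2 * (s * (r - s)) ≤ δ := by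
    rw [div_div, div_mul_eq_mul_div, div_le_iff₀ (by positivity)]
    nlinarith
  linarith
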